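/- arXiv:0902.4608 — 4 statements merged into one kernel-verified Lean document; each statement's English description precedes it below -/
import Mathlib

section
/- For every integer m ≥ 0 the following identity holds in the polynomial ring K[α, z]: (z + qα)^m = Σ_{s=0}^{m} F_{m,s}(α) · v_s(z) · (z − q)^{m−s}, where v_s(z) = q^{−s(s−1)/2} Σ_{i=0}^{s} ([s]! [2s−i]! / ([i]! ([s−i]!)²)) (z − q)^i and F_{m,s}(α) = q^{s(s+1)/2} · C(m,s) · ([s]!/[2s]!) · (1+α)^s · Σ_{i=0}^{m−s} ( (s−m)_i · ([s+1]_i)² / ( (s+1)_i · [2s+2]_i · [i]! ) ) · (q(1+α))^i, with C(m,s) the ordinary binomial coefficient. -/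
open Polynomial Finset

/-- Symmetric q-integer `[n] = (qⁿ − q⁻ⁿ)/(q − q⁻¹)` for `n : ℤ`. -/
noncomputable def qint {K : Type*} [Field K] (q : K) (n : ℤ) : K :=
  (q ^ n - q ^ (-n)) / (q - q⁻¹)

/-- q-factorial `[n]! = [1][2]⋯[n]`. -/
noncomputable def qfact {K : Type*} [Field K] (q : K) : ℕ → K
  | 0 => 1
  | n + 1 => qfact q n * qint q ((n : ℤ) + 1)

/-- Symmetric q-Pochhammer `[a]_i = [a][a+1]⋯[a+i−1]`. -/
noncomputable def qpoch {K : Type*} [Field K] (q : K) (a : ℤ) (i : ℕ) : K :=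
  ∏ t ∈ Finset.range i, qint q (a + t)

/-- Ordinary Pochhammer symbol `(a)_i = a(a+1)⋯(a+i−1)`, viewed in `K`. -/
noncomputable def poch {K : Type*} [Field K] (a : ℤ) (i : ℕ) : K :=
  ∏ t ∈ Finset.range i, ((a : K) + (t : K))

/-- The polynomial `v_s(z) = q^{−s(s−1)/2} Σ_{i=0}^{s} ([s]![2s−i]!/([i]!([s−i]!)²)) (z−q)^i`. -/
noncomputable def vpoly {K : Type*} [Field K] (q : K) (s : ℕ) : Polynomial K :=
  (q ^ (s * (s - 1) / 2))⁻¹ •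
    ∑ i ∈ Finset.range (s + 1),
      Polynomial.C (qfact q s * qfact q (2 * s - i) / (qfact q i * (qfact q (s - i)) ^ 2)) *
        (Polynomial.X - Polynomial.C q) ^ i

/-- The polynomial
`F_{m,s}(α) = q^{s(s+1)/2} C(m,s) ([s]!/[2s]!) (1+α)^s
   Σ_{i=0}^{m−s} ((s−m)_i ([s+1]_i)² / ((s+1)_i [2s+2]_i [i]!)) (q(1+α))^i`. -/
noncomputable def Fpoly {K : Type*} [Field K] (q : K) (m s : ℕ) : Polynomial K :=
  Polynomial.C (q ^ (s * (s + 1) / 2) * (Nat.choose m s : K) * qfact q s / qfact q (2 * s)) *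
    (1 + Polynomial.X) ^ s *
    ∑ i ∈ Finset.range (m - s + 1),
      Polynomial.C (poch ((s : ℤ) - (m : ℤ)) i * (qpoch q ((s : ℤ) + 1) i) ^ 2 /
          (poch ((s : ℤ) + 1) i * qpoch q (2 * (s : ℤ) + 2) i * qfact q i)) *
        (Polynomial.C q * (1 + Polynomial.X)) ^ i

section QIntegers

variable {K : Type*} [Field K] {q : K}

theorem qfact_succ (q : K) (n : ℕ) :
    qfact q (n + 1) = qfact q n * qint q ((n : ℤ) + 1) := rfl

theorem qint_zero (q : K) : qint q 0 = 0 := by simp [qint]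

theorem qint_ne_zero (hq : ∀ n : ℕ, 1 ≤ n → q ^ (n : ℤ) ≠ q ^ (-(n : ℤ))) (n : ℕ) :
    qint q ((n : ℤ) + 1) ≠ 0 := by
  have h1 := hq 1 le_rfl
  have hn := hq (n + 1) (by omega)
  push_cast at h1 hn
  rw [zpow_one, zpow_neg_one] at h1
  exact div_ne_zero (sub_ne_zero.2 hn) (sub_ne_zero.2 h1)

theorem qfact_ne_zero (hq : ∀ n : ℕ, 1 ≤ n → q ^ (n : ℤ) ≠ q ^ (-(n : ℤ))) (n : ℕ) :
    qfact q n ≠ 0 := by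
  induction n with
  | zero => exact one_ne_zero
  | succ n ih => exact mul_ne_zero ih (qint_ne_zero hq n)

theorem qint_mul_add_qint_mul (hq0 : q ≠ 0) (n t k : ℤ) :
    qint q (n + 1 + t) * qint q (k - n) + qint q (n - t) * qint q (n + k + 1) =
      qint q (2 * n + 1) * qint q (k - t) := by
  simp only [qint, div_mul_div_comm, ← add_div]
  congr 1
  simp only [two_mul, neg_add, neg_sub, zpow_add₀ hq0, zpow_sub₀ hq0, zpow_neg, zpow_one]
  field_simp
  ring

theorem qpoch_mul_qfact (q : K) (a i : ℕ) :
    qpoch q ((a : ℤ) + 1) i * qfact q a = qfact q (a + i) := by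
  induction i with
  | zero => simp [qpoch]
  | succ i ih =>
    rw [← add_assoc, qfact_succ, ← ih, qpoch, Finset.prod_range_succ, ← qpoch]
    push_cast
    rw [add_right_comm (a : ℤ) 1]
    ring

theorem poch_mul_factorial (a i : ℕ) :
    poch ((a : ℤ) + 1) i * (a.factorial : K) = ((a + i).factorial : K) := by
  induction i with
  | zero => simp [poch]
  | succ i ih =>
    rw [← add_assoc, Nat.factorial_succ, Nat.cast_mul, ← ih, poch, Finset.prod_range_succ, ← poch]
    push_cast
    ring

theorem poch_neg_mul_factorial (e i : ℕ) :
    poch (-((i + e : ℕ) : ℤ)) i * (e.factorial : K) = (-1) ^ i * ((i + e).factorial : K) := by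
  induction i generalizing e with
  | zero => simp [poch]
  | succ i ih =>
    have h := ih (e + 1)
    rw [show i + 1 + e = i + (e + 1) by ring, pow_succ, mul_right_comm, ← h, poch,
      Finset.prod_range_succ, ← poch, Nat.factorial_succ]
    push_cast
    ring

/-- The partial sums of the orthogonality relation telescope. -/
theorem qint_mul_sum_range (hq0 : q ≠ 0)
    (hq : ∀ n : ℕ, 1 ≤ n → q ^ (n : ℤ) ≠ q ^ (-(n : ℤ))) (t d n : ℕ) (hn : n ≤ d) :
    qint q d * ∑ u ∈ range n, (-1) ^ u * qint q (2 * ((t : ℤ) + u) + 1) * qfact q (2 * t + u) /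
        (qfact q u * qfact q (d - u) * qfact q (2 * t + d + u + 1)) =
      -((-1) ^ n * qint q n * qfact q (2 * t + n) /
        (qfact q n * qfact q (d - n) * qfact q (2 * t + d + n))) := by
  induction n with
  | zero => simp [qint_zero]
  | succ n ih =>
    obtain ⟨e, rfl⟩ := Nat.exists_eq_add_of_le hn
    rw [Finset.sum_range_succ, mul_add, ih (by omega)]
    have key := qint_mul_add_qint_mul hq0 ((t : ℤ) + n) t (t + (n + 1 + e))
    rw [show n + 1 + e - n = e + 1 by omega, show n + 1 + e - (n + 1) = e by omega,
      show 2 * t + (n + 1 + e) + (n + 1) = 2 * t + (n + 1 + e) + n + 1 by ring,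
      ← add_assoc (2 * t) n 1]
    simp only [qfact_succ]
    have h1 := qfact_ne_zero hq n
    have h2 := qfact_ne_zero hq e
    have h3 := qfact_ne_zero hq (2 * t + (n + 1 + e) + n)
    have h4 := qint_ne_zero hq n
    have h5 := qint_ne_zero hq e
    have h6 := qint_ne_zero hq (2 * t + (n + 1 + e) + n)
    push_cast at key h6 ⊢
    rw [show (t : ℤ) + n + 1 + t = 2 * t + n + 1 by ring,
      show (t : ℤ) + (n + 1 + e) - (t + n) = e + 1 by ring,
      show (t : ℤ) + n - t = n by ring,
      show (t : ℤ) + n + (t + (n + 1 + e)) + 1 = 2 * t + (n + 1 + e) + n + 1 by ring,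
      show (t : ℤ) + (n + 1 + e) - t = n + 1 + e by ring] at key
    field_simp
    linear_combination -(-1) ^ n * qfact q (2 * t + n) * key

theorem sum_range_orthogonality (hq0 : q ≠ 0)
    (hq : ∀ n : ℕ, 1 ≤ n → q ^ (n : ℤ) ≠ q ^ (-(n : ℤ))) (t d : ℕ) :
    ∑ u ∈ range (d + 1), (-1) ^ (d - u) * qint q (2 * ((t : ℤ) + u) + 1) * qfact q (2 * t + u) /
        (qfact q u * qfact q (d - u) * qfact q (2 * t + d + u + 1)) =
      if d = 0 then 1 else 0 := by
  have hsign : ∀ u ∈ range (d + 1),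
      (-1) ^ (d - u) * qint q (2 * ((t : ℤ) + u) + 1) * qfact q (2 * t + u) /
        (qfact q u * qfact q (d - u) * qfact q (2 * t + d + u + 1)) =
      (-1) ^ d * ((-1) ^ u * qint q (2 * ((t : ℤ) + u) + 1) * qfact q (2 * t + u) /
        (qfact q u * qfact q (d - u) * qfact q (2 * t + d + u + 1))) := by
    intro u hu
    obtain ⟨e, rfl⟩ := Nat.exists_eq_add_of_le (Nat.lt_succ_iff.1 (mem_range.1 hu))
    have hu2 : ((-1 : K) ^ u) * (-1) ^ u = 1 := by rw [← mul_pow]; simp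
    rw [Nat.add_sub_cancel_left, pow_add, ← mul_div_assoc]
    congr 1
    linear_combination (-(-1) ^ e * qint q (2 * ((t : ℤ) + u) + 1) * qfact q (2 * t + u)) * hu2
  rw [Finset.sum_congr rfl hsign, ← Finset.mul_sum]
  split_ifs with hd
  · subst hd
    have h1 := qfact_ne_zero hq (2 * t)
    have h2 := qint_ne_zero hq (2 * t)
    have h0 : qfact q 0 = 1 := rfl
    push_cast at h2
    simp only [zero_add, sum_range_one, pow_zero, Nat.cast_zero, add_zero, one_mul, h0, qfact_succ,
      Nat.sub_self]
    push_cast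
    rw [mul_comm, div_self (mul_ne_zero h1 h2)]
  · obtain ⟨d, rfl⟩ := Nat.exists_eq_succ_of_ne_zero hd
    have h := qint_mul_sum_range hq0 hq t (d + 1) (d + 1) le_rfl
    have hd0 := qint_ne_zero hq d
    refine mul_eq_zero_of_right _ ((mul_eq_zero.1 ?_).resolve_left hd0)
    rw [Nat.sub_self] at h
    push_cast at h
    rw [Finset.sum_range_succ, mul_add, h, Nat.sub_self, qfact_succ q (2 * t + (d + 1) + (d + 1))]
    have h1 := qfact_ne_zero hq (2 * t + (d + 1) + (d + 1))
    have h2 := qint_ne_zero hq (2 * t + (d + 1) + (d + 1))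
    have h3 := qfact_ne_zero hq (d + 1)
    have h4 := qfact_ne_zero hq 0
    push_cast at h2 ⊢
    rw [show 2 * ((t : ℤ) + (d + 1)) + 1 = 2 * t + (d + 1) + (d + 1) + 1 by ring]
    field_simp
    ring

/-- The scalar coefficient of `(q(1+α))^(s+i) (z-q)^(m-s+j)` in the `s`-th summand. -/
noncomputable def expansionCoeff (q : K) (m s i j : ℕ) : K :=
  (Nat.choose m s : K) * qfact q s / qfact q (2 * s) *
    (poch ((s : ℤ) - (m : ℤ)) i * (qpoch q ((s : ℤ) + 1) i) ^ 2 /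
      (poch ((s : ℤ) + 1) i * qpoch q (2 * (s : ℤ) + 2) i * qfact q i)) *
    (qfact q s * qfact q (2 * s - j) / (qfact q j * (qfact q (s - j)) ^ 2))

theorem choose_mul_poch_div_poch [CharZero K] (s i e : ℕ) :
    (Nat.choose (s + i + e) s : K) * poch ((s : ℤ) - ((s + i + e : ℕ) : ℤ)) i =
      (-1) ^ i * (Nat.choose (s + i + e) (s + i) : K) * poch ((s : ℤ) + 1) i := by
  have h1 := poch_mul_factorial (K := K) s i
  have h2 := poch_neg_mul_factorial (K := K) e i
  have h3 := Nat.add_choose_mul_factorial_mul_factorial s (i + e)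
  have h4 := Nat.add_choose_mul_factorial_mul_factorial (s + i) e
  rw [← Nat.choose_symm_add, ← add_assoc] at h3
  rw [← Nat.choose_symm_add] at h4
  rw [show (s : ℤ) - ((s + i + e : ℕ) : ℤ) = -((i + e : ℕ) : ℤ) by push_cast; ring]
  have hs : (s.factorial : K) ≠ 0 := by exact_mod_cast s.factorial_ne_zero
  have he : (e.factorial : K) ≠ 0 := by exact_mod_cast e.factorial_ne_zero
  have h3' := congrArg (Nat.cast : ℕ → K) h3
  have h4' := congrArg (Nat.cast : ℕ → K) h4
  push_cast [-Nat.cast_add] at h3' h4'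
  refine mul_right_cancel₀ (mul_ne_zero hs he) ?_
  linear_combination (Nat.choose (s + i + e) s : K) * s.factorial * h2 + (-1) ^ i * h3' -
    (-1) ^ i * h4' - (-1) ^ i * (Nat.choose (s + i + e) (s + i) : K) * e.factorial * h1

theorem expansionCoeff_eq [CharZero K]
    (hq : ∀ n : ℕ, 1 ≤ n → q ^ (n : ℤ) ≠ q ^ (-(n : ℤ))) (t j i e : ℕ) :
    expansionCoeff q (t + j + i + e) (t + j) i j =
      (Nat.choose (t + j + i + e) (t + j + i) : K) * qfact q (t + j + i) ^ 2 / qfact q t ^ 2 *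
        ((-1) ^ i * qint q (2 * ((t : ℤ) + j) + 1) * qfact q (2 * t + j) /
          (qfact q j * qfact q i * qfact q (2 * t + (j + i) + j + 1))) := by
  have hc := choose_mul_poch_div_poch (K := K) (t + j) i e
  have hp : (poch (((t + j : ℕ) : ℤ) + 1) i : K) ≠ 0 := by
    intro h
    have := poch_mul_factorial (K := K) (t + j) i
    rw [h, zero_mul] at this
    exact (t + j + i).factorial_ne_zero (by exact_mod_cast this.symm)
  have h1 := qpoch_mul_qfact q (t + j) i
  have h2 := qpoch_mul_qfact q (2 * (t + j) + 1) i
  rw [show 2 * (t + j) + 1 + i = 2 * t + (j + i) + j + 1 by ring, qfact_succ] at h2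
  have hn1 := qfact_ne_zero hq (t + j)
  have hn2 := qfact_ne_zero hq (2 * (t + j))
  have hn3 := qint_ne_zero hq (2 * (t + j))
  have hn4 := qfact_ne_zero hq (2 * t + (j + i) + j + 1)
  have hn5 := qfact_ne_zero hq i
  have hn6 := qfact_ne_zero hq j
  have hn7 := qfact_ne_zero hq t
  rw [show (((2 * (t + j) + 1 : ℕ) : ℤ) + 1) = 2 * ((t + j : ℕ) : ℤ) + 2 by push_cast; ring] at h2
  have hn8 : qpoch q (2 * ((t + j : ℕ) : ℤ) + 2) i ≠ 0 := by
    intro h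
    rw [h, zero_mul] at h2
    exact hn4 h2.symm
  rw [expansionCoeff, show 2 * (t + j) - j = 2 * t + j by omega, Nat.add_sub_cancel, ← h1, ← h2]
  rw [show (2 * ((t : ℤ) + j) + 1) = ((2 * (t + j) : ℕ) : ℤ) + 1 by push_cast; ring]
  field_simp
  linear_combination qpoch q (((t + j : ℕ) : ℤ) + 1) i ^ 2 * qfact q (2 * t + j) * hc

/-- The expansion of `F_{m,s}(α) v_s(z) (z - q)^(m-s)` in powers of `q(1+α)` and `z - q`. -/
theorem Fpoly_mul_vpoly_mul (hq0 : q ≠ 0) (m s : ℕ) :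
    C (Fpoly q m s) * (vpoly q s).map C * (X - C (C q)) ^ (m - s) =
      ∑ i ∈ range (m - s + 1), ∑ j ∈ range (s + 1),
        C (C (expansionCoeff q m s i j)) * C (C q * (1 + X)) ^ (s + i) *
          (X - C (C q)) ^ (m - s + j) := by
  have hpow : q ^ (s * (s + 1) / 2) = q ^ (s * (s - 1) / 2) * q ^ s := by
    rw [← pow_add]
    congr 1
    rcases s with _ | s
    · rfl
    · rw [Nat.add_sub_cancel, show (s + 1) * (s + 1 + 1) = (s + 1) * s + (s + 1) * 2 by ring,
        Nat.add_mul_div_right _ _ two_pos]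
  have hq1 : q ^ (s * (s - 1) / 2) ≠ 0 := pow_ne_zero _ hq0
  have hF : Fpoly q m s = C (q ^ (s * (s - 1) / 2)) *
      ∑ i ∈ range (m - s + 1), C ((Nat.choose m s : K) * qfact q s / qfact q (2 * s) *
        (poch ((s : ℤ) - (m : ℤ)) i * (qpoch q ((s : ℤ) + 1) i) ^ 2 /
          (poch ((s : ℤ) + 1) i * qpoch q (2 * (s : ℤ) + 2) i * qfact q i))) *
        (C q * (1 + X)) ^ (s + i) := by
    rw [Fpoly, hpow, Finset.mul_sum, Finset.mul_sum]
    refine Finset.sum_congr rfl fun i _ => ?_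
    rw [pow_add (C q * (1 + X)), mul_pow (C q) (1 + X) s, ← C_pow, mul_assoc (q ^ _ * q ^ s),
      mul_div_assoc, C_mul, C_mul, C_mul]
    ring
  have hv : (vpoly q s).map C = C (C (q ^ (s * (s - 1) / 2))⁻¹) *
      ∑ j ∈ range (s + 1),
        C (C (qfact q s * qfact q (2 * s - j) / (qfact q j * (qfact q (s - j)) ^ 2))) *
          (X - C (C q)) ^ j := by
    simp [vpoly, Polynomial.map_sum, smul_eq_C_mul]
  have hcancel :
      (C (C (q ^ (s * (s - 1) / 2))) * C (C (q ^ (s * (s - 1) / 2))⁻¹) : K[X][X]) = 1 := by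
    rw [← C_mul, ← C_mul, mul_inv_cancel₀ hq1, C_1, C_1]
  rw [hF, hv, C_mul, mul_mul_mul_comm, hcancel, one_mul, map_sum, Finset.sum_mul_sum,
    Finset.sum_mul]
  refine Finset.sum_congr rfl fun i _ => ?_
  rw [Finset.sum_mul]
  refine Finset.sum_congr rfl fun j _ => ?_
  simp only [expansionCoeff, C_mul, C_pow, pow_add]
  ring

/-- Resummation along `k = s + i` and `t = s - j`. -/
theorem sum_range_sum_range_sum_range_eq {M : Type*} [AddCommMonoid M] (m : ℕ)
    (f : ℕ → ℕ → ℕ → M) :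
    ∑ s ∈ range (m + 1), ∑ i ∈ range (m - s + 1), ∑ j ∈ range (s + 1), f s i j =
      ∑ k ∈ range (m + 1), ∑ t ∈ range (k + 1), ∑ u ∈ range (k - t + 1),
        f (t + u) (k - t - u) u := by
  have h1 := Finset.sum_range_diag_flip (m + 1) fun s i => ∑ j ∈ range (s + 1), f s i j
  have h2 : ∀ s ∈ range (m + 1), ∑ i ∈ range (m - s + 1), ∑ j ∈ range (s + 1), f s i j =
      ∑ i ∈ range (m + 1 - s), ∑ j ∈ range (s + 1), f s i j := fun s hs => by
    rw [Nat.sub_add_comm (Nat.lt_succ_iff.1 (mem_range.1 hs))]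
  rw [Finset.sum_congr rfl h2, ← h1]
  refine Finset.sum_congr rfl fun k _ => ?_
  have h3 := Finset.sum_range_diag_flip (k + 1) fun t u => f (t + u) (k - t - u) u
  have h4 : ∀ t ∈ range (k + 1), ∑ u ∈ range (k - t + 1), f (t + u) (k - t - u) u =
      ∑ u ∈ range (k + 1 - t), f (t + u) (k - t - u) u := fun t ht => by
    rw [Nat.sub_add_comm (Nat.lt_succ_iff.1 (mem_range.1 ht))]
  rw [Finset.sum_congr rfl h4, ← h3]
  refine Finset.sum_congr rfl fun s _ => ?_
  rw [← Finset.sum_range_reflect]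
  refine Finset.sum_congr rfl fun t ht => ?_
  have ht' := Nat.lt_succ_iff.1 (mem_range.1 ht)
  rw [Nat.add_sub_cancel, Nat.add_sub_cancel' ht', show k - t - (s - t) = k - s by omega]

theorem sum_expansionCoeff [CharZero K] (hq0 : q ≠ 0)
    (hq : ∀ n : ℕ, 1 ≤ n → q ^ (n : ℤ) ≠ q ^ (-(n : ℤ))) {m k t : ℕ} (hk : k ≤ m) (ht : t ≤ k) :
    ∑ u ∈ range (k - t + 1), expansionCoeff q m (t + u) (k - t - u) u =
      if t = k then (Nat.choose m k : K) else 0 := by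
  obtain ⟨d, rfl⟩ := Nat.exists_eq_add_of_le ht
  obtain ⟨e, rfl⟩ := Nat.exists_eq_add_of_le hk
  rw [Nat.add_sub_cancel_left]
  have h : ∀ u ∈ range (d + 1), expansionCoeff q (t + d + e) (t + u) (d - u) u =
      (Nat.choose (t + d + e) (t + d) : K) * qfact q (t + d) ^ 2 / qfact q t ^ 2 *
        ((-1) ^ (d - u) * qint q (2 * ((t : ℤ) + u) + 1) * qfact q (2 * t + u) /
          (qfact q u * qfact q (d - u) * qfact q (2 * t + d + u + 1))) := by
    intro u hu
    obtain ⟨i, rfl⟩ := Nat.exists_eq_add_of_le (Nat.lt_succ_iff.1 (mem_range.1 hu))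
    rw [Nat.add_sub_cancel_left, ← add_assoc t u i, expansionCoeff_eq hq]
  rw [Finset.sum_congr rfl h, ← Finset.mul_sum, sum_range_orthogonality hq0 hq]
  have hn := qfact_ne_zero hq t
  rcases Nat.eq_zero_or_pos d with rfl | hd
  · simp [hn]
  · rw [if_neg hd.ne', if_neg (by omega), mul_zero]

end QIntegers

/-- In `K[α][z]` (outer variable `z`, inner variable `α`):
`(z + qα)^m = Σ_{s=0}^{m} F_{m,s}(α) v_s(z) (z − q)^{m−s}`. -/
theorem stmt0 {K : Type*} [Field K] [CharZero K] (q : K) (hq0 : q ≠ 0)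
    (hq : ∀ n : ℕ, 1 ≤ n → q ^ (n : ℤ) ≠ q ^ (-(n : ℤ))) (m : ℕ) :
    (Polynomial.X + Polynomial.C (Polynomial.C q * Polynomial.X)) ^ m =
      ∑ s ∈ Finset.range (m + 1),
        Polynomial.C (Fpoly q m s) * (vpoly q s).map Polynomial.C *
          (Polynomial.X - Polynomial.C (Polynomial.C q)) ^ (m - s) := by
  have hsplit : (X + C (C q * X) : K[X][X]) = C (C q * (1 + X)) + (X - C (C q)) := by
    simp only [C_mul, C_add, C_1]
    ring
  simp only [Fpoly_mul_vpoly_mul hq0]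
  rw [hsplit, add_pow, sum_range_sum_range_sum_range_eq]
  refine Finset.sum_congr rfl fun k hk => ?_
  have hk' := Nat.lt_succ_iff.1 (mem_range.1 hk)
  have hterm : ∀ t ∈ range (k + 1), ∑ u ∈ range (k - t + 1),
      (C (C (expansionCoeff q m (t + u) (k - t - u) u)) *
        C (C q * (1 + X)) ^ (t + u + (k - t - u)) * (X - C (C q)) ^ (m - (t + u) + u) : K[X][X]) =
      if t = k then C (C (Nat.choose m k : K)) * C (C q * (1 + X)) ^ k *
        (X - C (C q)) ^ (m - k) else 0 := by
    intro t ht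
    have ht' := Nat.lt_succ_iff.1 (mem_range.1 ht)
    trans C (C (∑ u ∈ range (k - t + 1), expansionCoeff q m (t + u) (k - t - u) u)) *
      C (C q * (1 + X)) ^ k * (X - C (C q)) ^ (m - t)
    · simp only [map_sum, Finset.sum_mul]
      refine Finset.sum_congr rfl fun u hu => ?_
      have hu' := Nat.lt_succ_iff.1 (mem_range.1 hu)
      rw [show t + u + (k - t - u) = k by omega, show m - (t + u) + u = m - t by omega]
    · rw [sum_expansionCoeff hq0 hq hk' ht']
      split_ifs with h
      · rw [h]
      · simp
  rw [Finset.sum_congr rfl hterm, Finset.sum_ite_eq', if_pos (by simp)]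
  simp only [map_natCast]
  ring
end

section
/- In R, the elements z1 = x11·x22 and z2 = x12·x21 commute: z1·z2 = z2·z1. Moreover, for every integer l ≥ 0, x11^l · x22^l = Π_{r=1}^{l} (z1 + (q^{2r−1} − q)·z2), where the product is over the commuting factors z1 + (q^{2r−1} − q)z2, r = 1, …, l. -/
/-- If `a` `q`-commutes with `b` and with `c`, then it `q²`-commutes with `b * c`. -/
theorem mul_mul_eq_smul {K R : Type*} [Field K] [Ring R] [Algebra K R] {q : K} {a b c : R}
    (hb : a * b = q • (b * a)) (hc : a * c = q • (c * a)) :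
    a * (b * c) = (q * q) • (b * c * a) := by
  rw [← mul_assoc, hb, smul_mul_assoc, mul_assoc, hc, mul_smul_comm, smul_smul, mul_assoc]

theorem semiconjBy_list_prod_map {ι M : Type*} [Monoid M] {a : M} {f g : ι → M}
    (h : ∀ i, SemiconjBy a (f i) (g i)) (s : List ι) :
    SemiconjBy a (s.map f).prod (s.map g).prod := by
  induction s with
  | nil => simp
  | cons i s ih => simpa using (h i).mul_right ih

/-- In a `K`-algebra `R` with elements satisfying the quantum matrix relations,
`z1 = x11·x22` and `z2 = x12·x21` commute, and for every `l ≥ 0`,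
`x11^l · x22^l = Π_{r=1}^{l} (z1 + (q^{2r−1} − q)·z2)`. -/
theorem stmt11 {K R : Type*} [Field K] [CharZero K] [Ring R] [Algebra K R]
    (q : K) (hq0 : q ≠ 0)
    (hq : ∀ n : ℕ, 1 ≤ n → q ^ (n : ℤ) ≠ q ^ (-(n : ℤ)))
    (x11 x12 x21 x22 : R)
    (h1 : x11 * x12 = q • (x12 * x11))
    (h2 : x21 * x22 = q • (x22 * x21))
    (h3 : x11 * x21 = q • (x21 * x11))
    (h4 : x12 * x22 = q • (x22 * x12))
    (h5 : x12 * x21 = x21 * x12)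
    (h6 : x11 * x22 - x22 * x11 = (q - q⁻¹) • (x12 * x21)) :
    (x11 * x22) * (x12 * x21) = (x12 * x21) * (x11 * x22) ∧
    ∀ l : ℕ,
      x11 ^ l * x22 ^ l =
        ((List.range l).map
          (fun r => x11 * x22 + (q ^ (2 * r + 1) - q) • (x12 * x21))).prod := by
  have hcomm : Commute (x11 * x22) (x12 * x21) := by
    have hd : (x12 * x21) * x22 = (q * q) • (x22 * (x12 * x21)) := by
      rw [mul_assoc, h2, mul_smul_comm, ← mul_assoc, h4, smul_mul_assoc, smul_smul, mul_assoc]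
    have key : (q * q) • ((x11 * x22) * (x12 * x21)) =
        (q * q) • ((x12 * x21) * (x11 * x22)) := by
      rw [mul_assoc, ← mul_smul_comm, ← hd, ← mul_assoc, mul_mul_eq_smul h1 h3,
        smul_mul_assoc, mul_assoc]
    exact smul_right_injective R (mul_ne_zero hq0 hq0) key
  refine ⟨hcomm, fun l => ?_⟩
  set f : ℕ → R := fun r => x11 * x22 + (q ^ (2 * r + 1) - q) • (x12 * x21) with hf
  have hshift (r : ℕ) : SemiconjBy x11 (f r) (f (r + 1)) := by
    have hz1 : x11 * (x11 * x22) =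
        x11 * x22 * x11 + ((q - q⁻¹) * (q * q)) • (x12 * x21 * x11) := by
      rw [sub_eq_iff_eq_add'.mp h6, mul_add, mul_smul_comm, mul_mul_eq_smul h1 h3, smul_smul,
        ← sub_eq_iff_eq_add'.mp h6, mul_assoc x11 x22 x11]
    change x11 * f r = f (r + 1) * x11
    simp only [hf]
    rw [mul_add, hz1, mul_smul_comm, mul_mul_eq_smul h1 h3, smul_smul, add_mul, smul_mul_assoc,
      add_assoc, ← add_smul]
    congr 2
    field_simp
    ring
  have hzero : f 0 = x11 * x22 := by simp [hf]
  induction l with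
  | zero => simp
  | succ l ih =>
    have hc : Commute (f 0) ((List.range l).map fun r => f (r + 1)).prod := by
      refine Commute.list_prod_right _ _ fun y hy => ?_
      obtain ⟨r, -, rfl⟩ := List.mem_map.mp hy
      rw [hzero]
      exact (Commute.refl _).add_right (hcomm.smul_right _)
    have hs := semiconjBy_list_prod_map hshift (List.range l)
    rw [List.range_succ_eq_map, List.map_cons, List.prod_cons, List.map_map]
    change _ = f 0 * ((List.range l).map fun r => f (r + 1)).prod
    rw [hc.eq, hzero, ← mul_assoc, ← hs.eq, ← ih, pow_succ', pow_succ]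
    simp only [mul_assoc]
end

section
/- For every integer m ≥ 0, the following identity holds in ℚ[α, z]: (z + α)^m = Σ_{s=0}^{m} F_s(α) · v_s(z) · (z − 1)^{m−s}, where v_s(z) = Σ_{i=0}^{s} (s!(2s−i)!/(i!((s−i)!)²)) (z − 1)^i and F_s(α) = (m!/((m−s)!(2s)!)) · (1+α)^s · Σ_{i=0}^{m−s} ( (s−m)_i (s+1)_i / ((2s+2)_i · i!) ) · (1+α)^i. -/
open Polynomial Finset

/-- Ordinary Pochhammer symbol `(a)_i = a(a+1)⋯(a+i−1)` for `a : ℤ`, viewed in `ℚ`. -/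
def pochQ (a : ℤ) (i : ℕ) : ℚ :=
  ∏ t ∈ Finset.range i, ((a : ℚ) + (t : ℚ))

/-- The polynomial `v_s(z) = Σ_{i=0}^{s} (s!(2s−i)!/(i!((s−i)!)²)) (z − 1)^i` over `ℚ`. -/
noncomputable def vC (s : ℕ) : Polynomial ℚ :=
  ∑ i ∈ Finset.range (s + 1),
    Polynomial.C ((s.factorial * (2 * s - i).factorial : ℚ) /
        (i.factorial * ((s - i).factorial : ℚ) ^ 2)) *
      (Polynomial.X - 1) ^ i

/-- The polynomial
`F_s(α) = (m!/((m−s)!(2s)!)) (1+α)^s Σ_{i=0}^{m−s} ((s−m)_i (s+1)_i / ((2s+2)_i i!)) (1+α)^i`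
over `ℚ`. -/
noncomputable def FC (m s : ℕ) : Polynomial ℚ :=
  Polynomial.C ((m.factorial : ℚ) / ((m - s).factorial * (2 * s).factorial)) *
    (1 + Polynomial.X) ^ s *
    ∑ i ∈ Finset.range (m - s + 1),
      Polynomial.C (pochQ ((s : ℤ) - (m : ℤ)) i * pochQ ((s : ℤ) + 1) i /
          (pochQ (2 * (s : ℤ) + 2) i * (i.factorial : ℚ))) *
        (1 + Polynomial.X) ^ i

theorem pochQ_succ (a : ℤ) (i : ℕ) : pochQ a (i + 1) = pochQ a i * ((a : ℚ) + i) := by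
  simp [pochQ, Finset.prod_range_succ]

theorem pochQ_natCast_succ (a i : ℕ) :
    pochQ ((a : ℤ) + 1) i = ((a + i).factorial : ℚ) / a.factorial := by
  induction i with
  | zero => simp [pochQ, Nat.factorial_ne_zero]
  | succ i ih =>
    rw [pochQ_succ, ih, ← add_assoc, Nat.factorial_succ]
    push_cast
    ring

theorem pochQ_neg_natCast (d i : ℕ) :
    pochQ (-((i + d : ℕ) : ℤ)) i = (-1) ^ i * ((i + d).factorial : ℚ) / d.factorial := by
  induction i generalizing d with
  | zero => simp [pochQ, Nat.factorial_ne_zero]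
  | succ i ih =>
    rw [pochQ_succ, show i + 1 + d = i + (d + 1) by ring, ih, Nat.factorial_succ d]
    have : (d.factorial : ℚ) ≠ 0 := by positivity
    have : (d + 1 : ℚ) ≠ 0 := by positivity
    push_cast
    field_simp
    ring

/-- The coefficient of `(1 + α) ^ n` in `FC m s`, for `s ≤ n ≤ m`. -/
def coeffF (m s n : ℕ) : ℚ :=
  (m.factorial * n.factorial * (2 * s + 1) * (-1) ^ (n - s)) /
    ((m - n).factorial * (n - s).factorial * (n + s + 1).factorial * s.factorial)

/-- The coefficient of `(z - 1) ^ (s - k)` in `vC s`, for `k ≤ s`. -/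
def coeffV (s k : ℕ) : ℚ :=
  (s.factorial * (s + k).factorial) / ((s - k).factorial * (k.factorial : ℚ) ^ 2)

theorem coeffF_add (s i d : ℕ) :
    ((s + i + d).factorial : ℚ) / ((i + d).factorial * (2 * s).factorial) *
      (pochQ (-((i + d : ℕ) : ℤ)) i * pochQ ((s : ℤ) + 1) i /
        (pochQ (2 * (s : ℤ) + 2) i * (i.factorial : ℚ))) = coeffF (s + i + d) s (s + i) := by
  have h : (2 * (s : ℤ) + 2) = ((2 * s + 1 : ℕ) : ℤ) + 1 := by push_cast; ring
  rw [h, pochQ_natCast_succ, pochQ_natCast_succ, pochQ_neg_natCast, coeffF,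
    show s + i + d - (s + i) = d by lia, show s + i - s = i by lia,
    show s + i + s + 1 = 2 * s + 1 + i by ring, Nat.factorial_succ (2 * s)]
  have := Nat.factorial_ne_zero
  push_cast
  field_simp

theorem sum_range_ite_le {M : Type*} [AddCommMonoid M] {s m : ℕ} (h : s ≤ m) (f : ℕ → M) :
    ∑ n ∈ range (m + 1), (if s ≤ n then f n else 0) = ∑ i ∈ range (m - s + 1), f (s + i) := by
  obtain ⟨d, rfl⟩ := Nat.exists_eq_add_of_le h
  rw [add_assoc, sum_range_add, sum_eq_zero, zero_add]
  · simp
  · intro n hn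
    rw [if_neg (by simpa using hn)]

theorem sum_range_ite_ge {M : Type*} [AddCommMonoid M] {s m : ℕ} (h : s ≤ m) (f : ℕ → M) :
    ∑ k ∈ range (m + 1), (if k ≤ s then f k else 0) = ∑ i ∈ range (s + 1), f (s - i) := by
  obtain ⟨d, rfl⟩ := Nat.exists_eq_add_of_le h
  rw [show s + d + 1 = s + 1 + d by ring, sum_range_add, sum_eq_zero (s := range d), add_zero,
    ← sum_range_reflect]
  · simp
  · intro n hn
    rw [if_neg (by lia)]

theorem FC_eq_sum {m s : ℕ} (h : s ≤ m) :
    FC m s = ∑ n ∈ range (m + 1), C (if s ≤ n then coeffF m s n else 0) * (1 + X) ^ n := by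
  have : ∀ n, C (if s ≤ n then coeffF m s n else 0) * (1 + X : ℚ[X]) ^ n =
      if s ≤ n then C (coeffF m s n) * (1 + X) ^ n else 0 := by
    intro n; split_ifs <;> simp
  simp_rw [this]
  rw [sum_range_ite_le h, FC, mul_sum]
  refine sum_congr rfl fun i hi => ?_
  obtain ⟨d, rfl⟩ : ∃ d, m = s + i + d := Nat.exists_eq_add_of_le (by rw [mem_range] at hi; lia)
  rw [← coeffF_add, show s + i + d - s = i + d by lia,
    show (s : ℤ) - ((s + i + d : ℕ) : ℤ) = -((i + d : ℕ) : ℤ) by push_cast; ring, C_mul, pow_add]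
  ring

theorem vC_mul_eq_sum {m s : ℕ} (h : s ≤ m) :
    vC s * (X - 1) ^ (m - s) =
      ∑ k ∈ range (m + 1), C (if k ≤ s then coeffV s k else 0) * (X - 1) ^ (m - k) := by
  have : ∀ k, C (if k ≤ s then coeffV s k else 0) * (X - 1 : ℚ[X]) ^ (m - k) =
      if k ≤ s then C (coeffV s k) * (X - 1) ^ (m - k) else 0 := by
    intro n; split_ifs <;> simp
  simp_rw [this]
  rw [sum_range_ite_ge h, vC, sum_mul]
  refine sum_congr rfl fun i hi => ?_
  rw [mem_range] at hi
  rw [coeffV, show s - (s - i) = i by lia, show s + (s - i) = 2 * s - i by lia,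
    show m - (s - i) = i + (m - s) by lia, pow_add, mul_assoc]

theorem sum_range_telescope (k d J : ℕ) (hJ : J ≤ d) :
    (d : ℚ) * ∑ j ∈ range (J + 1), ((-1) ^ j * (2 * (k + j) + 1) * (2 * k + j).factorial : ℚ) /
        ((2 * k + d + j + 1).factorial * (d - j).factorial * j.factorial) =
      ((-1) ^ J * (2 * k + J + 1).factorial * (d - J)) /
        ((2 * k + d + J + 1).factorial * (d - J).factorial * J.factorial) := by
  have hf := Nat.factorial_ne_zero
  induction J with
  | zero =>
    simp [Nat.factorial_succ (2 * k)]
    field_simp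
  | succ J ih =>
    obtain ⟨e, rfl⟩ := Nat.exists_eq_add_of_le hJ
    rw [sum_range_succ, mul_add, ih (by lia), show J + 1 + e - J = e + 1 by lia,
      show J + 1 + e - (J + 1) = e by lia,
      show 2 * k + (J + 1 + e) + (J + 1) + 1 = 2 * k + (J + 1 + e) + J + 1 + 1 by ring,
      Nat.factorial_succ (2 * k + (J + 1 + e) + J + 1), Nat.factorial_succ e,
      Nat.factorial_succ J, show 2 * k + (J + 1) + 1 = 2 * k + J + 1 + 1 by ring,
      Nat.factorial_succ (2 * k + J + 1), ← add_assoc (2 * k) J 1]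
    have : (2 * k + (J + 1 + e) + J + 1 + 1 : ℚ) ≠ 0 := by positivity
    push_cast
    field_simp
    ring

theorem sum_coeff_mul_coeff {m n k : ℕ} (hn : n ≤ m) (hk : k ≤ m) :
    ∑ s ∈ range (m + 1), (if s ≤ n then coeffF m s n else 0) * (if k ≤ s then coeffV s k else 0) =
      if n = k then (m.choose n : ℚ) else 0 := by
  have hf := Nat.factorial_ne_zero
  have hite : ∀ s, (if s ≤ n then coeffF m s n else 0) * (if k ≤ s then coeffV s k else 0) =
      if k ≤ s then (if s ≤ n then coeffF m s n * coeffV s k else 0) else 0 := by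
    intro s; split_ifs <;> simp
  simp_rw [hite]
  rw [sum_range_ite_le hk]
  rcases lt_or_ge n k with h | h
  · rw [if_neg h.ne]
    exact sum_eq_zero fun i _ => if_neg (by lia)
  obtain ⟨d, rfl⟩ := Nat.exists_eq_add_of_le h
  have hge := sum_range_ite_ge (s := d) (m := m - k) (by lia)
    (fun i => coeffF m (k + i) (k + d) * coeffV (k + i) k)
  simp only [add_le_add_iff_left]
  rw [hge, ← sum_range_reflect]
  rcases Nat.eq_zero_or_pos d with rfl | hd
  · simp [coeffF, coeffV, Nat.cast_choose ℚ hk, Nat.factorial_succ (k + k)]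
    have : (2 * k + 1 : ℚ) ≠ 0 := by positivity
    have : (k + k + 1 : ℚ) ≠ 0 := by positivity
    field_simp
    ring
  · rw [if_neg (by lia)]
    have hd' : (d : ℚ) ≠ 0 := by positivity
    have ht := sum_range_telescope k d d le_rfl
    rw [sub_self, mul_zero, zero_div] at ht
    have hz := (mul_eq_zero.mp ht).resolve_left hd'
    rw [← mul_zero ((-1) ^ d * (m.factorial * (k + d).factorial : ℚ) /
      ((m - (k + d)).factorial * (k.factorial : ℚ) ^ 2)), ← hz, mul_sum]
    refine sum_congr rfl fun j hj => ?_
    obtain ⟨e, rfl⟩ := Nat.exists_eq_add_of_le (show j ≤ d by rw [mem_range] at hj; lia)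
    rw [show j + e - (j + e + 1 - 1 - j) = j by lia, coeffF, coeffV,
      show k + (j + e) - (k + j) = e by lia, show k + j - k = j by lia,
      show j + e - j = e by lia, show k + j + k = 2 * k + j by ring,
      show k + (j + e) + (k + j) + 1 = 2 * k + (j + e) + j + 1 by ring]
    have hs : ((-1 : ℚ) ^ j) * (-1) ^ j = 1 := by rw [← mul_pow]; simp
    push_cast
    rw [pow_add]
    field_simp
    linear_combination (-(1 : ℚ)) * hs

/-- In `ℚ[α][z]` (outer variable `z`, inner variable `α`):
`(z + α)^m = Σ_{s=0}^{m} F_s(α) v_s(z) (z − 1)^{m−s}`. -/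
theorem stmt14 (m : ℕ) :
    (Polynomial.X + Polynomial.C Polynomial.X) ^ m =
      ∑ s ∈ Finset.range (m + 1),
        Polynomial.C (FC m s) * (vC s).map Polynomial.C *
          (Polynomial.X - 1) ^ (m - s) := by
  have hterm : ∀ s ∈ range (m + 1),
      C (FC m s) * (vC s).map C * (X - 1) ^ (m - s) =
        ∑ n ∈ range (m + 1), ∑ k ∈ range (m + 1),
          C (C ((if s ≤ n then coeffF m s n else 0) * (if k ≤ s then coeffV s k else 0))) *
            (C (1 + X) ^ n * (X - 1) ^ (m - k)) := by
    intro s hs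
    have hs : s ≤ m := by rw [mem_range] at hs; lia
    have hv := congrArg (Polynomial.map (C : ℚ →+* ℚ[X])) (vC_mul_eq_sum hs)
    simp only [Polynomial.map_mul, Polynomial.map_pow, Polynomial.map_sub, map_X,
      Polynomial.map_one, Polynomial.map_sum, map_C] at hv
    rw [mul_assoc, hv, FC_eq_sum hs, map_sum, sum_mul_sum]
    refine sum_congr rfl fun n _ => sum_congr rfl fun k _ => ?_
    rw [C_mul, C_pow, C_mul, C_mul]
    ring
  rw [sum_congr rfl hterm, sum_comm,
    show (X + C X : ℚ[X][X]) = C (1 + X) + (X - 1) by rw [C_add, C_1]; ring, add_pow]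
  refine sum_congr rfl fun n hn => ?_
  rw [sum_comm]
  simp_rw [← sum_mul, ← map_sum]
  rw [sum_eq_single_of_mem n hn]
  · rw [sum_coeff_mul_coeff (by rw [mem_range] at hn; lia) (by rw [mem_range] at hn; lia),
      if_pos rfl]
    simp only [map_natCast]
    ring
  · intro k hk hkn
    rw [sum_coeff_mul_coeff (by rw [mem_range] at hn; lia) (by rw [mem_range] at hk; lia),
      if_neg hkn.symm]
    simp
end

section
/- For all integers 0 ≤ s ≤ m, the following identity holds in ℚ[α]: (m!/((m−s)!(2s)!)) · (1+α)^s · Σ_{i=0}^{m−s} ( (s−m)_i (s+1)_i / ((2s+2)_i · i!) ) · (1+α)^i = ((C(2m, m−s) − C(2m, m−s−1)) / (C(2m, m) · s!)) · (1+α)^s · Σ_{i=0}^{m−s} ( (s−m)_i (s+1)_i / ((−m)_i · i!) ) · (−α)^i, where C(n,k) denotes the ordinary binomial coefficient (with C(n,k) = 0 for k < 0) and (−m)_i ≠ 0 for 0 ≤ i ≤ m−s. -/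
open Polynomial Finset

/-- Binomial coefficient `C(n,k)` with integer lower index, vanishing for `k < 0`. -/
def chooseZ (n : ℕ) (k : ℤ) : ℚ :=
  if k < 0 then 0 else (n.choose k.toNat : ℚ)

theorem pochQ_succ_left (a : ℤ) (n : ℕ) : pochQ a (n + 1) = a * pochQ (a + 1) n := by
  simp only [pochQ, prod_range_succ']
  rw [mul_comm]
  congr 1
  · simp
  · refine prod_congr rfl fun t _ => ?_
    push_cast
    ring

theorem pochQ_succ_right (a : ℤ) (n : ℕ) : pochQ a (n + 1) = pochQ a n * (a + n) := by
  simp only [pochQ, prod_range_succ]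

theorem pochQ_mul_factorial (k i : ℕ) :
    pochQ ((k : ℤ) + 1) i * (k.factorial : ℚ) = ((k + i).factorial : ℚ) := by
  induction i with
  | zero => simp [pochQ]
  | succ i ih =>
    rw [pochQ_succ_right, ← add_assoc, Nat.factorial_succ]
    push_cast
    rw [← ih]
    ring

theorem pochQ_neg_mul_factorial (k i : ℕ) :
    pochQ (-((k + i : ℕ) : ℤ)) i * (k.factorial : ℚ) = (-1) ^ i * ((k + i).factorial : ℚ) := by
  induction i with
  | zero => simp [pochQ]
  | succ i ih =>
    have h : (-((k + (i + 1) : ℕ) : ℤ)) + 1 = -((k + i : ℕ) : ℤ) := by push_cast; ring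
    rw [pochQ_succ_left, h, mul_assoc, ih, ← add_assoc, Nat.factorial_succ]
    push_cast
    ring

/-- Denominator-free form of the reflection `x ↦ 1 - x` for a terminating `₂F₁`. -/
theorem sum_antidiagonal_pochQ_reflect {A : Type*} [CommRing A] [Algebra ℚ A] (x : A) (n : ℕ)
    (b c : ℤ) :
    ∑ p ∈ antidiagonal n, (n.choose p.1 : A) *
        (algebraMap ℚ A (pochQ b p.1 * pochQ (c + p.1) p.2) * (-x) ^ p.1) =
      ∑ p ∈ antidiagonal n, (n.choose p.1 : A) *
        (algebraMap ℚ A (pochQ b p.1 * pochQ (c - b) p.2) * (1 - x) ^ p.1) := by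
  induction n generalizing b c with
  | zero => simp [pochQ]
  | succ n ih =>
    rw [sum_antidiagonal_choose_succ_mul
        (fun i j => algebraMap ℚ A (pochQ b i * pochQ (c + i) j) * (-x) ^ i),
      sum_antidiagonal_choose_succ_mul
        (fun i j => algebraMap ℚ A (pochQ b i * pochQ (c - b) j) * (1 - x) ^ i)]
    have h₁ := ih b (c + 1)
    have h₂ := ih (b + 1) (c + 1)
    rw [show c + 1 - b = c - b + 1 by ring] at h₁
    rw [show c + 1 - (b + 1) = c - b by ring] at h₂
    have key := congrArg₂ (· + ·)
      (congrArg (fun y => algebraMap ℚ A ((c - b : ℤ) : ℚ) * y) h₁)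
      (congrArg (fun y => algebraMap ℚ A (b : ℚ) * (1 - x) * y) h₂)
    simp only [mul_sum, ← sum_add_distrib] at key ⊢
    refine Eq.trans (Eq.trans (sum_congr rfl fun p hp => ?_) key) (sum_congr rfl fun p hp => ?_)
    · have hc : n.choose p.2 = n.choose p.1 := by
        rw [← mem_antidiagonal.1 hp]; exact (Nat.choose_symm_add).symm
      have hb : (b : ℚ) * pochQ (b + 1) p.1 = pochQ b p.1 * (b + p.1) := by
        rw [← pochQ_succ_left, pochQ_succ_right]
      have hb' := congrArg (algebraMap ℚ A) hb
      rw [hc, pochQ_succ_left (c + p.1), pochQ_succ_right b,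
        show c + 1 + (p.1 : ℤ) = c + p.1 + 1 by ring,
        show c + ((p.1 + 1 : ℕ) : ℤ) = c + p.1 + 1 by push_cast; ring]
      push_cast
      simp only [map_mul, map_add, map_natCast, map_intCast] at hb' ⊢
      linear_combination (-(n.choose p.1 : A) * (1 - x) * (-x) ^ p.1 *
        algebraMap ℚ A (pochQ (c + p.1 + 1) p.2)) * hb'
    · have hc : n.choose p.2 = n.choose p.1 := by
        rw [← mem_antidiagonal.1 hp]; exact (Nat.choose_symm_add).symm
      rw [hc, pochQ_succ_left (c - b), pochQ_succ_left b]
      push_cast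
      simp only [map_intCast]
      ring

theorem pochQ_natCast_add_one (k i : ℕ) :
    pochQ ((k : ℤ) + 1) i = ((k + i).factorial : ℚ) / k.factorial :=
  eq_div_of_mul_eq (Nat.cast_ne_zero.2 k.factorial_ne_zero) (pochQ_mul_factorial k i)

theorem pochQ_neg_natCast_add (k i : ℕ) :
    pochQ (-((k + i : ℕ) : ℤ)) i = (-1) ^ i * ((k + i).factorial : ℚ) / k.factorial :=
  eq_div_of_mul_eq (Nat.cast_ne_zero.2 k.factorial_ne_zero) (pochQ_neg_mul_factorial k i)

theorem chooseZ_sub_chooseZ (s n : ℕ) :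
    (chooseZ (2 * (s + n)) n - chooseZ (2 * (s + n)) ((n : ℤ) - 1)) *
        ((n.factorial : ℚ) * ((2 * s + 1 + n).factorial : ℚ)) =
      ((2 * (s + n)).factorial : ℚ) * (2 * s + 1) := by
  have h₀ : chooseZ (2 * (s + n)) n * ((n.factorial : ℚ) * ((2 * s + n).factorial : ℚ)) =
      ((2 * (s + n)).factorial : ℚ) := by
    have h := Nat.add_choose_mul_factorial_mul_factorial (2 * s + n) n
    rw [show 2 * s + n + n = 2 * (s + n) by ring] at h
    simp only [chooseZ, Int.toNat_natCast, if_neg (not_lt.2 (Int.natCast_nonneg n))]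
    rw [← h]
    push_cast
    ring
  have h₁ : chooseZ (2 * (s + n)) ((n : ℤ) - 1) *
      ((n.factorial : ℚ) * ((2 * s + 1 + n).factorial : ℚ)) =
        ((2 * (s + n)).factorial : ℚ) * n := by
    cases n with
    | zero => simp [chooseZ]
    | succ k =>
      have h := Nat.add_choose_mul_factorial_mul_factorial (2 * s + 1 + (k + 1)) k
      rw [show 2 * s + 1 + (k + 1) + k = 2 * (s + (k + 1)) by ring] at h
      have hk : ((k + 1 : ℕ) : ℤ) - 1 = k := by push_cast; ring
      simp only [hk, chooseZ, Int.toNat_natCast, if_neg (not_lt.2 (Int.natCast_nonneg k))]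
      rw [← h, Nat.factorial_succ k]
      push_cast
      ring
  have h₂ : ((2 * s + 1 + n).factorial : ℚ) = (2 * s + 1 + n) * ((2 * s + n).factorial : ℚ) := by
    rw [show 2 * s + 1 + n = 2 * s + n + 1 by ring, Nat.factorial_succ]
    push_cast
    ring
  rw [sub_mul, h₁, h₂]
  linear_combination (2 * s + 1 + n : ℚ) * h₀

/-- For `0 ≤ s ≤ m`, in `ℚ[α]`:
`(m!/((m−s)!(2s)!)) (1+α)^s Σ_{i=0}^{m−s} ((s−m)_i (s+1)_i/((2s+2)_i i!)) (1+α)^i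
 = ((C(2m,m−s) − C(2m,m−s−1))/(C(2m,m) s!)) (1+α)^s
   Σ_{i=0}^{m−s} ((s−m)_i (s+1)_i/((−m)_i i!)) (−α)^i`. -/
theorem stmt15 (m s : ℕ) (hsm : s ≤ m) :
    Polynomial.C ((m.factorial : ℚ) / ((m - s).factorial * (2 * s).factorial)) *
        (1 + Polynomial.X) ^ s *
        ∑ i ∈ Finset.range (m - s + 1),
          Polynomial.C (pochQ ((s : ℤ) - (m : ℤ)) i * pochQ ((s : ℤ) + 1) i /
              (pochQ (2 * (s : ℤ) + 2) i * (i.factorial : ℚ))) *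
            (1 + Polynomial.X) ^ i =
      Polynomial.C ((chooseZ (2 * m) ((m : ℤ) - (s : ℤ)) -
            chooseZ (2 * m) ((m : ℤ) - (s : ℤ) - 1)) /
          ((Nat.choose (2 * m) m : ℚ) * (s.factorial : ℚ))) *
        (1 + Polynomial.X) ^ s *
        ∑ i ∈ Finset.range (m - s + 1),
          Polynomial.C (pochQ ((s : ℤ) - (m : ℤ)) i * pochQ ((s : ℤ) + 1) i /
              (pochQ (-(m : ℤ)) i * (i.factorial : ℚ))) *
            (-Polynomial.X) ^ i := by
  obtain ⟨n, rfl⟩ := Nat.exists_eq_add_of_le hsm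
  have hfac (k : ℕ) : (k.factorial : ℚ) ≠ 0 := Nat.cast_ne_zero.2 k.factorial_ne_zero
  have hn : s + n - s = n := by omega
  have hz : ((s + n : ℕ) : ℤ) - s = n := by push_cast; ring
  have hz' : (s : ℤ) - ((s + n : ℕ) : ℤ) = -(n : ℤ) := by push_cast; ring
  have hz'' : 2 * (s : ℤ) + 2 = ((2 * s + 1 : ℕ) : ℤ) + 1 := by push_cast; ring
  rw [hn, hz, hz', hz'']
  have key := sum_antidiagonal_pochQ_reflect (1 + X : ℚ[X]) n ((s : ℤ) + 1)
    (((2 * s + 1 : ℕ) : ℤ) + 1)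
  have hL : ∑ i ∈ range (n + 1),
      C (pochQ (-(n : ℤ)) i * pochQ ((s : ℤ) + 1) i /
        (pochQ (((2 * s + 1 : ℕ) : ℤ) + 1) i * (i.factorial : ℚ))) * (1 + X) ^ i =
      C (((2 * s + 1).factorial : ℚ) / (2 * s + 1 + n).factorial) *
        ∑ p ∈ antidiagonal n, (n.choose p.1 : ℚ[X]) *
          (algebraMap ℚ ℚ[X] (pochQ ((s : ℤ) + 1) p.1 *
            pochQ (((2 * s + 1 : ℕ) : ℤ) + 1 + p.1) p.2) * (-(1 + X)) ^ p.1) := by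
    rw [← Finset.Nat.sum_antidiagonal_eq_sum_range_succ (fun i _ =>
      C (pochQ (-(n : ℤ)) i * pochQ ((s : ℤ) + 1) i /
        (pochQ (((2 * s + 1 : ℕ) : ℤ) + 1) i * (i.factorial : ℚ))) * (1 + X) ^ i), mul_sum]
    refine sum_congr rfl fun p hp => ?_
    obtain ⟨i, j⟩ := p
    obtain rfl : j + i = n := by rw [add_comm]; exact mem_antidiagonal.1 hp
    have h : ((2 * s + 1 : ℕ) : ℤ) + 1 + i = ((2 * s + 1 + i : ℕ) : ℤ) + 1 := by push_cast; ring
    rw [neg_pow (1 + X : ℚ[X]), ← Polynomial.C_eq_natCast, Polynomial.algebraMap_eq,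
      show (-1 : ℚ[X]) ^ i = C ((-1) ^ i) by simp]
    simp only [← mul_assoc, ← C_mul]
    congr 2
    rw [h, pochQ_neg_natCast_add, pochQ_natCast_add_one (2 * s + 1),
      pochQ_natCast_add_one (2 * s + 1 + i), ← Nat.add_choose_mul_factorial_mul_factorial j i,
      show 2 * s + 1 + (j + i) = 2 * s + 1 + i + j by ring]
    have := hfac i
    have := hfac j
    have := hfac (2 * s + 1)
    have := hfac (2 * s + 1 + i)
    have := hfac (2 * s + 1 + i + j)
    push_cast
    field_simp
  have hR : ∑ i ∈ range (n + 1),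
      C (pochQ (-(n : ℤ)) i * pochQ ((s : ℤ) + 1) i /
        (pochQ (-((s + n : ℕ) : ℤ)) i * (i.factorial : ℚ))) * (-X) ^ i =
      C ((s.factorial : ℚ) / (s + n).factorial) *
        ∑ p ∈ antidiagonal n, (n.choose p.1 : ℚ[X]) *
          (algebraMap ℚ ℚ[X] (pochQ ((s : ℤ) + 1) p.1 *
            pochQ (((2 * s + 1 : ℕ) : ℤ) + 1 - ((s : ℤ) + 1)) p.2) * (1 - (1 + X)) ^ p.1) := by
    rw [← Finset.Nat.sum_antidiagonal_eq_sum_range_succ (fun i _ =>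
      C (pochQ (-(n : ℤ)) i * pochQ ((s : ℤ) + 1) i /
        (pochQ (-((s + n : ℕ) : ℤ)) i * (i.factorial : ℚ))) * (-X) ^ i), mul_sum]
    refine sum_congr rfl fun p hp => ?_
    obtain ⟨i, j⟩ := p
    obtain rfl : j + i = n := by rw [add_comm]; exact mem_antidiagonal.1 hp
    have h : ((2 * s + 1 : ℕ) : ℤ) + 1 - ((s : ℤ) + 1) = (s : ℤ) + 1 := by push_cast; ring
    rw [show (1 - (1 + X) : ℚ[X]) = -X by ring, ← Polynomial.C_eq_natCast,
      Polynomial.algebraMap_eq]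
    simp only [← mul_assoc, ← C_mul]
    congr 2
    rw [h, show s + (j + i) = s + j + i by ring, pochQ_neg_natCast_add, pochQ_neg_natCast_add,
      pochQ_natCast_add_one s j, ← Nat.add_choose_mul_factorial_mul_factorial j i]
    have := hfac i
    have := hfac j
    have := hfac s
    have := hfac (s + j)
    have := hfac (s + j + i)
    push_cast
    field_simp
  rw [hL, hR, key]
  have hconst : ((s + n).factorial : ℚ) / (n.factorial * (2 * s).factorial) *
      ((2 * s + 1).factorial / (2 * s + 1 + n).factorial) =
      (chooseZ (2 * (s + n)) n - chooseZ (2 * (s + n)) ((n : ℤ) - 1)) /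
        (((2 * (s + n)).choose (s + n) : ℚ) * s.factorial) *
        (s.factorial / (s + n).factorial) := by
    have h := Nat.add_choose_mul_factorial_mul_factorial (s + n) (s + n)
    rw [← two_mul] at h
    have hd : (chooseZ (2 * (s + n)) n - chooseZ (2 * (s + n)) ((n : ℤ) - 1)) = _ :=
      eq_div_of_mul_eq (mul_ne_zero (hfac n) (hfac (2 * s + 1 + n))) (chooseZ_sub_chooseZ s n)
    have hc : ((2 * (s + n)).choose (s + n) : ℚ) ≠ 0 :=
      Nat.cast_ne_zero.2 (Nat.choose_pos (by omega)).ne'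
    rw [hd, ← h, Nat.factorial_succ (2 * s)]
    have := hfac n
    have := hfac s
    have := hfac (2 * s)
    have := hfac (s + n)
    have := hfac (2 * s + 1 + n)
    push_cast
    field_simp
  have hC := congrArg (C : ℚ → ℚ[X]) hconst
  rw [C_mul, C_mul] at hC
  rw [mul_mul_mul_comm, hC, mul_mul_mul_comm]
end
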